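/- arXiv:1312.6886 — 4 statements merged into one kernel-verified Lean document; each statement's English description precedes it below -/
import Mathlib

section
/- Let Ω be a finite set with |Ω| = n, let K be a nonempty finite set of permutations of Ω with minimal support size μ = min_{σ∈K} β(σ), let B ⊊ K be a proper subset, and let μ* = min_{σ∈K∖B} β(σ). Then for 0 < m < n, the number u_m^K of pairs (σ, x) with σ ∈ K, x an m-element subset of Ω, and σ(x) = x, satisfies u_m^K ≤ e^{n·h(λ)} · ((|K| − |B|)·ξ₁^{μ*} + |B|·ξ₁^{μ}), where λ = m/n, ξ₁ = √(m² + (n−m)²)/n, and h(p) = −p·ln p − (1−p)·ln(1−p). -/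
open Finset

/-- Binary entropy function `h(p) = -p ln p - (1-p) ln(1-p)`. -/
noncomputable def binEnt (p : ℝ) : ℝ := -p * Real.log p - (1 - p) * Real.log (1 - p)

lemma fiber_bound {l : ℕ} (hl : 2 ≤ l) {p q ξ : ℝ} (hp : 0 ≤ p) (hq : 0 ≤ q)
    (hξ0 : 0 ≤ ξ) (hξ : ξ ^ 2 = p ^ 2 + q ^ 2) : p ^ l + q ^ l ≤ ξ ^ l := by
  obtain ⟨k, rfl⟩ := Nat.exists_eq_add_of_le hl
  have h1 : p ≤ ξ := by
    refine (sq_le_sq₀ (by assumption) hξ0).1 ?_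
    nlinarith [sq_nonneg q]
  have h2 : q ≤ ξ := by
    refine (sq_le_sq₀ (by assumption) hξ0).1 ?_
    nlinarith [sq_nonneg p]
  rw [pow_add, pow_add, pow_add, hξ, add_mul]
  gcongr

lemma inv_sameCycle {Ω : Type*} [Fintype Ω] [DecidableEq Ω] (σ : Equiv.Perm Ω)
    (x : Finset Ω) (hx : x.image ⇑σ = x) {a b : Ω} (hab : σ.SameCycle a b) (ha : a ∈ x) :
    b ∈ x := by
  obtain ⟨k, hk⟩ := hab.exists_nat_pow_eq
  subst hk
  clear hab
  induction k with
  | zero => simpa using ha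
  | succ k ih =>
    rw [pow_succ', Equiv.Perm.mul_apply, ← hx]
    exact Finset.mem_image_of_mem _ ih

lemma single_bound {Ω : Type*} [Fintype Ω] [DecidableEq Ω] (σ : Equiv.Perm Ω) (m : ℕ)
    {p q ξ : ℝ} (hp : 0 ≤ p) (hq : 0 ≤ q) (hpq : p + q = 1)
    (hξ0 : 0 ≤ ξ) (hξ : ξ ^ 2 = p ^ 2 + q ^ 2) :
    (((univ : Finset (Finset Ω)).filter
      (fun x => x.card = m ∧ x.image ⇑σ = x)).card : ℝ) * (p ^ m * q ^ (Fintype.card Ω - m))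
      ≤ ξ ^ σ.support.card := by
  classical
  let Q := Quotient (Equiv.Perm.SameCycle.setoid σ)
  let mk : Ω → Q := fun a => Quotient.mk _ a
  have hmk : ∀ a b, mk a = mk b ↔ σ.SameCycle a b := fun a b => Quotient.eq
  let f : Q → ℕ := fun c => ((univ : Finset Ω).filter (fun a => mk a = c)).card
  let g : Finset Q → ℝ := fun T => (∏ c ∈ T, p ^ f c) * ∏ c ∈ univ \ T, q ^ f c
  have hf : ∑ c, f c = Fintype.card Ω := by
    rw [← Finset.card_univ (α := Ω)]
    exact (Finset.card_eq_sum_card_fiberwise (f := mk) (t := univ) (fun _ _ => by simp)).symm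
  have hg : ∀ x ∈ ((univ : Finset (Finset Ω)).filter
      (fun x => x.card = m ∧ x.image ⇑σ = x)), g (x.image mk) = p ^ m * q ^ (Fintype.card Ω - m) := by
    intro x hx
    obtain ⟨-, hxm, hxi⟩ := Finset.mem_filter.1 hx
    have h1 : ∑ c ∈ x.image mk, f c = m := by
      rw [← hxm, Finset.card_eq_sum_card_image mk x]
      refine Finset.sum_congr rfl fun c hc => ?_
      obtain ⟨a, ha, rfl⟩ := Finset.mem_image.1 hc
      refine congrArg Finset.card ?_
      ext b
      simp only [Finset.mem_filter, Finset.mem_univ, true_and]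
      refine ⟨fun h => ⟨?_, h⟩, fun h => h.2⟩
      exact inv_sameCycle σ x hxi ((hmk _ _).1 h.symm) ha
    have h2 : ∑ c ∈ univ \ x.image mk, f c = Fintype.card Ω - m := by
      have := Finset.sum_sdiff (f := f) (Finset.subset_univ (x.image mk))
      omega
    simp only [g]
    rw [Finset.prod_pow_eq_pow_sum, Finset.prod_pow_eq_pow_sum, h1, h2]
  have hinj : Set.InjOn (fun x : Finset Ω => x.image mk) ((univ : Finset (Finset Ω)).filter
      (fun x => x.card = m ∧ x.image ⇑σ = x)) := by
    have key : ∀ x y : Finset Ω, y.image ⇑σ = y → x.image mk = y.image mk → x ⊆ y := by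
      intro x y hy h a ha
      have : mk a ∈ y.image mk := h ▸ Finset.mem_image_of_mem mk ha
      obtain ⟨b, hb, hab⟩ := Finset.mem_image.1 this
      exact inv_sameCycle σ y hy ((hmk _ _).1 hab) hb
    intro x hx y hy h
    have hx' := (Finset.mem_filter.1 (Finset.mem_coe.1 hx)).2.2
    have hy' := (Finset.mem_filter.1 (Finset.mem_coe.1 hy)).2.2
    exact Finset.Subset.antisymm (key x y hy' h) (key y x hx' h.symm)
  calc _ = ∑ x ∈ ((univ : Finset (Finset Ω)).filter
      (fun x => x.card = m ∧ x.image ⇑σ = x)), g (x.image mk) := by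
        rw [Finset.sum_congr rfl hg, Finset.sum_const, nsmul_eq_mul]
    _ = ∑ T ∈ (((univ : Finset (Finset Ω)).filter
      (fun x => x.card = m ∧ x.image ⇑σ = x))).image (fun x => x.image mk), g T := by
        rw [Finset.sum_image hinj]
    _ ≤ ∑ T ∈ (univ : Finset Q).powerset, g T := by
        apply Finset.sum_le_sum_of_subset_of_nonneg
        · intro T _
          simp
        · intro T _ _
          simp only [g]
          positivity
    _ = ∏ c : Q, (p ^ f c + q ^ f c) := by
        rw [Finset.prod_add]
    _ ≤ ∏ c : Q, ∏ a ∈ (univ : Finset Ω).filter (fun a => mk a = c),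
          (if σ a = a then 1 else ξ) := by
        apply Finset.prod_le_prod
        · intro c _
          positivity
        · intro c _
          obtain ⟨a, rfl⟩ : ∃ a, mk a = c := Quotient.exists_rep c
          by_cases ha : σ a = a
          · have hs : (univ : Finset Ω).filter (fun b => mk b = mk a) = {a} := by
              ext b
              simp only [Finset.mem_filter, Finset.mem_univ, true_and, Finset.mem_singleton]
              constructor
              · intro h
                have h' := ((hmk _ _).1 h).symm
                exact (h'.eq_of_left ha).symm
              · rintro rfl
                rfl
            have hfa : f (mk a) = 1 := by simp only [f, hs, Finset.card_singleton]
            rw [hs, hfa]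
            simp [ha, hpq]
          · have hprod : ∏ b ∈ (univ : Finset Ω).filter (fun b => mk b = mk a),
                (if σ b = b then 1 else ξ) = ξ ^ f (mk a) := by
              rw [Finset.prod_congr rfl (g := fun _ => ξ), Finset.prod_const]
              intro b hb
              rw [if_neg]
              intro hbb
              have h' := (hmk _ _).1 (Finset.mem_filter.1 hb).2
              have : b = a := h'.eq_of_left hbb
              exact ha (this ▸ hbb)
            rw [hprod]
            apply fiber_bound _ hp hq hξ0 hξ
            have : 1 < f (mk a) := by
              apply Finset.one_lt_card.2
              refine ⟨σ a, ?_, a, ?_, ha⟩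
              · simp only [Finset.mem_filter, Finset.mem_univ, true_and]
                rw [hmk]
                exact Equiv.Perm.sameCycle_apply_left.2 (Equiv.Perm.SameCycle.refl σ a)
              · simp
            exact this
    _ = ∏ a : Ω, (if σ a = a then 1 else ξ) := by
        exact Finset.prod_fiberwise _ mk _
    _ = ξ ^ σ.support.card := by
        rw [Finset.prod_ite, Finset.prod_const_one, one_mul, Finset.prod_const]
        rfl

/-- Corollary 3.3, inequality (22): with `B ⊊ K`, `μ = min_{σ∈K} β(σ)` and
`μ* = min_{σ∈K∖B} β(σ)`, the number of passive pairs satisfies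
`u_m^K ≤ exp (n h(λ)) * ((|K| - |B|) ξ₁^{μ*} + |B| ξ₁^{μ})`. -/
theorem stmt_7 {Ω : Type*} [Fintype Ω] [DecidableEq Ω] (n m : ℕ)
    (hn : Fintype.card Ω = n) (hm0 : 0 < m) (hmn : m < n)
    (K : Finset (Equiv.Perm Ω)) (hK : K.Nonempty)
    (B : Finset (Equiv.Perm Ω)) (hB : B ⊂ K) (μ μs : ℕ)
    (hμ : μ = sInf {k : ℕ | ∃ σ ∈ K, σ.support.card = k})
    (hμs : μs = sInf {k : ℕ | ∃ σ ∈ K \ B, σ.support.card = k}) :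
    (((K ×ˢ (univ : Finset (Finset Ω))).filter
        (fun p => p.2.card = m ∧ p.2.image ⇑p.1 = p.2)).card : ℝ) ≤
      Real.exp (n * binEnt ((m : ℝ) / n)) *
        (((K.card : ℝ) - B.card) *
            (Real.sqrt ((m : ℝ) ^ 2 + ((n : ℝ) - m) ^ 2) / n) ^ μs +
          (B.card : ℝ) *
            (Real.sqrt ((m : ℝ) ^ 2 + ((n : ℝ) - m) ^ 2) / n) ^ μ) := by
  have hn0 : (0 : ℝ) < n := by exact_mod_cast hm0.trans hmn
  have hm0' : (0 : ℝ) < m := by exact_mod_cast hm0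
  have hmn' : (m : ℝ) < n := by exact_mod_cast hmn
  set ξ : ℝ := Real.sqrt ((m : ℝ) ^ 2 + ((n : ℝ) - m) ^ 2) / n with hξdef
  set E : ℝ := Real.exp (n * binEnt ((m : ℝ) / n)) with hE
  have hξ0 : 0 ≤ ξ := by positivity
  have hp : 0 < (m : ℝ) / n := by positivity
  have hq : 0 < 1 - (m : ℝ) / n := by
    rw [sub_pos, div_lt_one hn0]
    exact hmn'
  have hξ : ξ ^ 2 = ((m : ℝ) / n) ^ 2 + (1 - (m : ℝ) / n) ^ 2 := by
    rw [hξdef, div_pow, Real.sq_sqrt (by positivity)]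
    field_simp
  have hξ1 : ξ ≤ 1 := by
    refine (sq_le_sq₀ hξ0 zero_le_one).1 ?_
    rw [hξ]
    nlinarith
  have hEw : ((m : ℝ) / n) ^ m * (1 - (m : ℝ) / n) ^ (n - m) * E = 1 := by
    have h1 : ((m : ℝ) / n) ^ m = Real.exp (m * Real.log ((m : ℝ) / n)) := by
      rw [mul_comm, Real.exp_mul, Real.exp_log hp, Real.rpow_natCast]
    have h2 : (1 - (m : ℝ) / n) ^ (n - m) =
        Real.exp (((n - m : ℕ) : ℝ) * Real.log (1 - (m : ℝ) / n)) := by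
      rw [mul_comm, Real.exp_mul, Real.exp_log hq, Real.rpow_natCast]
    rw [h1, h2, hE, ← Real.exp_add, ← Real.exp_add, Real.exp_eq_one_iff, Nat.cast_sub hmn.le, binEnt]
    generalize Real.log (1 - (m : ℝ) / n) = L
    generalize Real.log ((m : ℝ) / n) = M
    field_simp
    ring
  have hE0 : 0 < E := Real.exp_pos _
  have hσ : ∀ σ : Equiv.Perm Ω, (((univ : Finset (Finset Ω)).filter
      (fun x => x.card = m ∧ x.image ⇑σ = x)).card : ℝ) ≤ E * ξ ^ σ.support.card := by
    intro σ
    have h := single_bound σ m hp.le hq.le (by ring) hξ0 hξ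
    rw [hn] at h
    have h2 := mul_le_mul_of_nonneg_left h hE0.le
    refine le_trans (le_of_eq ?_) h2
    linear_combination (-(((univ : Finset (Finset Ω)).filter
      (fun x => x.card = m ∧ x.image ⇑σ = x)).card : ℝ)) * hEw
  have hcard : (((K ×ˢ (univ : Finset (Finset Ω))).filter
        (fun p => p.2.card = m ∧ p.2.image ⇑p.1 = p.2)).card : ℝ) =
      ∑ σ ∈ K, (((univ : Finset (Finset Ω)).filter
      (fun x => x.card = m ∧ x.image ⇑σ = x)).card : ℝ) := by
    rw [← Nat.cast_sum]
    congr 1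
    simp only [Finset.card_filter]
    rw [Finset.sum_product]
  rw [hcard, ← Finset.sum_sdiff hB.subset, mul_add]
  apply add_le_add
  · have : ((K.card : ℝ) - B.card) = ((K \ B).card : ℝ) := by
      rw [Finset.cast_card_sdiff hB.subset]
    rw [this, mul_left_comm, ← nsmul_eq_mul]
    apply Finset.sum_le_card_nsmul
    intro σ hs
    refine (hσ σ).trans ?_
    apply mul_le_mul_of_nonneg_left _ hE0.le
    apply pow_le_pow_of_le_one hξ0 hξ1
    rw [hμs]
    exact Nat.sInf_le ⟨σ, hs, rfl⟩
  · rw [mul_left_comm, ← nsmul_eq_mul]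
    apply Finset.sum_le_card_nsmul
    intro σ hs
    refine (hσ σ).trans ?_
    apply mul_le_mul_of_nonneg_left _ hE0.le
    apply pow_le_pow_of_le_one hξ0 hξ1
    rw [hμ]
    exact Nat.sInf_le ⟨σ, hB.subset hs, rfl⟩
end

section
/- Let Ω be a finite set with |Ω| = n ≥ 1, let K be a nonempty finite set of permutations of Ω with minimal support size μ = min_{σ∈K} β(σ), let B ⊊ K be a proper subset, and let μ* = min_{σ∈K∖B} β(σ). Then for m > 0, the number u_{(m)}^K of pairs (σ, κ) with σ ∈ K and κ a σ-invariant multiset of size m on Ω satisfies u_{(m)}^K ≤ e^{(n+m)·h(η)} · ((|K| − |B|)·ξ₂^{μ*} + |B|·ξ₂^{μ}), where η = m/(n+m), ξ₂ = √(n/(n+2m)), and h(p) = −p·ln p − (1−p)·ln(1−p). -/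
open Finset

lemma inv_sameCycle_s8 {Ω : Type*} [Fintype Ω] (σ : Equiv.Perm Ω) (κ : Ω → ℕ)
    (h : κ ∘ ⇑σ = κ) {a b : Ω} (hab : σ.SameCycle a b) : κ a = κ b := by
  obtain ⟨i, -, hi⟩ := hab.exists_pow_eq' 
  rw [← hi]
  clear hi
  induction i with
  | zero => simp
  | succ k ih => 
    rw [pow_succ', Equiv.Perm.mul_apply, ih]
    exact (congrFun h _).symm

lemma fiber_bound_s8 {Ω : Type*} [Fintype Ω] [DecidableEq Ω] (σ : Equiv.Perm Ω) (x a ξ : ℝ)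
    (hx0 : 0 < x) (hx1 : x < 1) (ha : a * (1 - x) = 1) (hξ : 0 < ξ)
    (h2 : (a * ξ) ^ 2 * (1 - x ^ 2) = 1) (s : Finset Ω) (ω₀ : Ω)
    (hs : ∀ ω, ω ∈ s ↔ σ.SameCycle ω ω₀) :
    (1 - x ^ s.card)⁻¹ ≤ ∏ ω ∈ s, (a * if ω ∈ σ.support then ξ else 1) := by
  have hapos : 0 < a := by
    by_contra hneg
    nlinarith
  by_cases hf : σ ω₀ = ω₀
  · have : s = {ω₀} := by
      ext ω
      rw [hs, Finset.mem_singleton]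
      constructor
      · intro h
        exact (h.symm.eq_of_left hf).symm
      · rintro rfl
        exact Equiv.Perm.SameCycle.refl _ _
    subst this
    simp only [card_singleton, pow_one, prod_singleton, Equiv.Perm.mem_support, hf, ne_eq,
      not_true_eq_false, if_false, mul_one]
    exact (eq_inv_of_mul_eq_one_left ha).ge
  · have hcard : 2 ≤ s.card := by
      rw [← Finset.card_pair hf]
      apply Finset.card_le_card
      intro y hy
      rw [hs]
      rcases Finset.mem_insert.1 hy with rfl | hy
      · simp [Equiv.Perm.SameCycle.refl]
      · rw [Finset.mem_singleton.1 hy]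
    have hmem : ∀ ω ∈ s, (a * if ω ∈ σ.support then ξ else 1) = a * ξ := by
      intro ω h
      rw [if_pos]
      rw [Equiv.Perm.mem_support]
      intro hω
      apply hf
      have := ((hs ω).1 h).eq_of_left hω
      rw [← this, hω]
    rw [Finset.prod_congr rfl hmem, Finset.prod_const]
    have hp : 0 < a * ξ := mul_pos hapos hξ
    have hx2 : x ^ s.card ≤ x ^ 2 := pow_le_pow_of_le_one hx0.le hx1.le hcard
    have hx3 : x ^ 2 < 1 := by nlinarith
    have h1 : 1 ≤ a * ξ := by
      by_contra hlt
      push Not at hlt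
      have : (a * ξ) ^ 2 < 1 := by nlinarith
      nlinarith [sq_nonneg x, sq_nonneg (a * ξ), mul_nonneg (sq_nonneg x) (sq_nonneg (a * ξ))]
    calc (1 - x ^ s.card)⁻¹ ≤ (1 - x ^ 2)⁻¹ := by
          apply inv_anti₀ <;> linarith
      _ = (a * ξ) ^ 2 := (eq_inv_of_mul_eq_one_left h2).symm
      _ ≤ (a * ξ) ^ s.card := pow_le_pow_right₀ h1 hcard

lemma perm_bound {Ω : Type*} [Fintype Ω] [DecidableEq Ω] (σ : Equiv.Perm Ω) (m : ℕ) (x a ξ : ℝ)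
    (hx0 : 0 < x) (hx1 : x < 1) (ha : a * (1 - x) = 1) (hξ : 0 < ξ)
    (h2 : (a * ξ) ^ 2 * (1 - x ^ 2) = 1) :
    (((Fintype.piFinset (fun _ : Ω => Finset.range (m + 1))).filter
      (fun κ => (∑ ω, κ ω) = m ∧ κ ∘ ⇑σ = κ)).card : ℝ) * x ^ m ≤
      a ^ (Fintype.card Ω) * ξ ^ σ.support.card := by
  classical
  set S := (Fintype.piFinset (fun _ : Ω => Finset.range (m + 1))).filter
      (fun κ => (∑ ω, κ ω) = m ∧ κ ∘ ⇑σ = κ) with hS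
  let st := Equiv.Perm.SameCycle.setoid σ
  let Q := Quotient st
  let f : Ω → Q := Quotient.mk st
  let l : Q → ℕ := fun q => (univ.filter (fun ω => f ω = q)).card
  have hfib : ∀ (q : Q) (ω : Ω), f ω = q ↔ σ.SameCycle ω q.out := by
    intro q ω
    conv_lhs => rw [← Quotient.out_eq q]
    exact Quotient.eq (r := st)
  let g : (Ω → ℕ) → (Q → ℕ) := fun κ q => κ q.out
  have hgval : ∀ κ ∈ S, ∀ ω, κ ω = g κ (f ω) := by
    intro κ hκ ω
    exact inv_sameCycle_s8 σ κ (Finset.mem_filter.1 hκ).2.2 ((hfib (f ω) ω).1 rfl)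
  have hinj : Set.InjOn g S := by
    intro κ hκ κ' hκ' h
    ext ω
    rw [hgval κ hκ, hgval κ' hκ', h]
  have hsum : ∀ κ ∈ S, x ^ m = ∏ q : Q, (x ^ l q) ^ (g κ q) := by
    intro κ hκ
    have : m = ∑ q : Q, l q * g κ q := by
      rw [← (Finset.mem_filter.1 hκ).2.1, ← Finset.sum_fiberwise univ f κ]
      refine Finset.sum_congr rfl fun q _ => ?_
      rw [Finset.sum_congr rfl (g := fun _ => g κ q), Finset.sum_const, smul_eq_mul]
      intro ω hω
      rw [hgval κ hκ, (Finset.mem_filter.1 hω).2]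
    conv_lhs => rw [this]
    rw [← Finset.prod_pow_eq_pow_sum]
    exact Finset.prod_congr rfl fun q _ => pow_mul _ _ _
  have hlpos : ∀ q, l q ≠ 0 := by
    intro q
    apply Finset.card_ne_zero_of_mem (a := q.out)
    simp [f]
  calc (S.card : ℝ) * x ^ m = ∑ κ ∈ S, x ^ m := by simp
    _ = ∑ κ ∈ S, ∏ q : Q, (x ^ l q) ^ (g κ q) := Finset.sum_congr rfl hsum
    _ = ∑ κ ∈ S.image g, ∏ q : Q, (x ^ l q) ^ (κ q) := (Finset.sum_image 
          (f := fun κ : Q → ℕ => ∏ q : Q, (x ^ l q) ^ (κ q)) hinj).symm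
    _ ≤ ∑ κ ∈ Fintype.piFinset (fun _ : Q => Finset.range (m + 1)), 
          ∏ q : Q, (x ^ l q) ^ (κ q) := by
        apply Finset.sum_le_sum_of_subset_of_nonneg
        · intro κ' h
          obtain ⟨κ, hκ, rfl⟩ := Finset.mem_image.1 h
          rw [Fintype.mem_piFinset]
          intro q
          exact Fintype.mem_piFinset.1 (Finset.mem_filter.1 hκ).1 _
        · intros
          positivity
    _ = ∏ q : Q, ∑ j ∈ Finset.range (m + 1), (x ^ l q) ^ j := by
        rw [Finset.prod_univ_sum]
    _ ≤ ∏ q : Q, ∏ ω ∈ univ.filter (fun ω => f ω = q), (a * if ω ∈ σ.support then ξ else 1) := by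
        apply Finset.prod_le_prod
        · intros
          positivity
        · intro q _
          refine le_trans ?_ (fiber_bound_s8 σ x a ξ hx0 hx1 ha hξ h2 _ q.out ?_)
          · have h0 : 0 ≤ x ^ l q := by positivity
            have h1 : x ^ l q < 1 := pow_lt_one₀ hx0.le hx1 (hlpos q)
            rw [← tsum_geometric_of_lt_one h0 h1]
            exact (summable_geometric_of_lt_one h0 h1).sum_le_tsum _ (fun _ _ => by positivity)
          · intro ω
            simp [hfib]
    _ = ∏ ω, (a * if ω ∈ σ.support then ξ else 1) := Finset.prod_fiberwise _ _ _
    _ = _ := by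
        rw [Finset.prod_mul_distrib, Finset.prod_const, Finset.prod_ite, Finset.prod_const,
          Finset.prod_const_one, mul_one, Finset.filter_univ_mem, Finset.card_univ]

/-- Corollary 3.3, inequality (23): with `B ⊊ K`, `μ = min_{σ∈K} β(σ)` and
`μ* = min_{σ∈K∖B} β(σ)`, the number of passive pairs `(σ, κ)` with `σ ∈ K` and `κ` a
`σ`-invariant multiset of size `m` satisfies
`u_{(m)}^K ≤ exp ((n+m) h(η)) * ((|K| - |B|) ξ₂^{μ*} + |B| ξ₂^{μ})`. -/
theorem stmt_8 {Ω : Type*} [Fintype Ω] [DecidableEq Ω] (n m : ℕ)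
    (hn : Fintype.card Ω = n) (hn1 : 1 ≤ n) (hm : 0 < m)
    (K : Finset (Equiv.Perm Ω)) (hK : K.Nonempty)
    (B : Finset (Equiv.Perm Ω)) (hB : B ⊂ K) (μ μs : ℕ)
    (hμ : μ = sInf {k : ℕ | ∃ σ ∈ K, σ.support.card = k})
    (hμs : μs = sInf {k : ℕ | ∃ σ ∈ K \ B, σ.support.card = k}) :
    ({p : Equiv.Perm Ω × (Ω → ℕ) |
        p.1 ∈ K ∧ (∑ ω, p.2 ω) = m ∧ p.2 ∘ ⇑p.1 = p.2}.ncard : ℝ) ≤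
      Real.exp (((n : ℝ) + m) * binEnt ((m : ℝ) / ((n : ℝ) + m))) *
        (((K.card : ℝ) - B.card) *
            Real.sqrt ((n : ℝ) / ((n : ℝ) + 2 * m)) ^ μs +
          (B.card : ℝ) * Real.sqrt ((n : ℝ) / ((n : ℝ) + 2 * m)) ^ μ) := by
  classical
  have hnpos : (0 : ℝ) < n := by exact_mod_cast hn1
  have hmpos : (0 : ℝ) < m := by exact_mod_cast hm
  set ξ := Real.sqrt ((n : ℝ) / ((n : ℝ) + 2 * m)) with hξdef
  have hξ : 0 < ξ := Real.sqrt_pos.2 (by positivity)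
  have hξ2 : ξ ^ 2 = (n : ℝ) / ((n : ℝ) + 2 * m) := Real.sq_sqrt (by positivity)
  have hξ1 : ξ ≤ 1 := by
    rw [hξdef, Real.sqrt_le_one, div_le_one (by positivity)]
    linarith
  set x : ℝ := (m : ℝ) / ((n : ℝ) + m) with hx
  have hx0 : 0 < x := by positivity
  have hx1 : x < 1 := by
    rw [hx, div_lt_one (by positivity)]
    linarith
  have h1x : 1 - x = (n : ℝ) / (n + m) := by
    rw [hx]
    field_simp
    ring
  have ha : (1 - x)⁻¹ * (1 - x) = 1 := inv_mul_cancel₀ (by linarith)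
  have h2 : ((1 - x)⁻¹ * ξ) ^ 2 * (1 - x ^ 2) = 1 := by
    rw [mul_pow, hξ2, h1x, hx]
    field_simp
    ring
  set E := Real.exp (((n : ℝ) + m) * binEnt x) with hE
  have hEeq : E * x ^ m = (1 - x)⁻¹ ^ n := by
    have e1 : x ^ m = Real.exp (m * Real.log x) := by
      rw [mul_comm, Real.exp_mul, Real.exp_log hx0, Real.rpow_natCast]
    have e2 : (1 - x) ^ n = Real.exp (n * Real.log (1 - x)) := by
      rw [mul_comm, Real.exp_mul, Real.exp_log (by linarith), Real.rpow_natCast]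
    rw [inv_pow, e1, e2, ← Real.exp_neg, hE, ← Real.exp_add]
    congr 1
    unfold binEnt
    have hm' : ((n : ℝ) + m) * x = m := by
      rw [hx]
      field_simp
    have hn' : ((n : ℝ) + m) * (1 - x) = n := by linarith
    linear_combination (-Real.log x) * hm' - Real.log (1 - x) * hn'
  have hxm : 0 < x ^ m := by positivity
  have hEpos : 0 < E := Real.exp_pos _
  let N : Equiv.Perm Ω → ℕ := fun σ =>
    ((Fintype.piFinset (fun _ : Ω => Finset.range (m + 1))).filter
      (fun κ => (∑ ω, κ ω) = m ∧ κ ∘ ⇑σ = κ)).card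
  have hN : ∀ σ, (N σ : ℝ) ≤ E * ξ ^ σ.support.card := by
    intro σ
    have := perm_bound σ m x (1 - x)⁻¹ ξ hx0 hx1 ha hξ h2
    rw [hn, ← hEeq] at this
    refine le_of_mul_le_mul_right ?_ hxm
    calc _ ≤ _ := this
      _ = _ := by ring
  have hcount : {p : Equiv.Perm Ω × (Ω → ℕ) |
        p.1 ∈ K ∧ (∑ ω, p.2 ω) = m ∧ p.2 ∘ ⇑p.1 = p.2}.ncard = ∑ σ ∈ K, N σ := by
    have : {p : Equiv.Perm Ω × (Ω → ℕ) |
        p.1 ∈ K ∧ (∑ ω, p.2 ω) = m ∧ p.2 ∘ ⇑p.1 = p.2} =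
        ((K ×ˢ (Fintype.piFinset (fun _ : Ω => Finset.range (m + 1)))).filter
          (fun p => (∑ ω, p.2 ω) = m ∧ p.2 ∘ ⇑p.1 = p.2) :
            Finset (Equiv.Perm Ω × (Ω → ℕ))) := by
      ext p
      simp only [Set.mem_ofPred_eq, Finset.coe_filter, Finset.mem_product, Fintype.mem_piFinset,
        Finset.mem_range]
      constructor
      · rintro ⟨h1, h2, h3⟩
        refine ⟨⟨h1, fun ω => ?_⟩, h2, h3⟩
        have := Finset.single_le_sum (f := p.2) (fun _ _ => Nat.zero_le _) (Finset.mem_univ ω)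
        omega
      · rintro ⟨⟨h1, -⟩, h2, h3⟩
        exact ⟨h1, h2, h3⟩
    rw [this, Set.ncard_coe_finset, Finset.card_filter, Finset.sum_product]
    refine Finset.sum_congr rfl fun σ _ => ?_
    rw [← Finset.card_filter]
  rw [hcount, ← Finset.sum_sdiff hB.1]
  push_cast
  rw [mul_add]
  have hc : ((K \ B).card : ℝ) = (K.card : ℝ) - B.card := by
    rw [Finset.card_sdiff_of_subset hB.1, Nat.cast_sub (Finset.card_le_card hB.1)]
  apply add_le_add
  · calc _ ≤ ∑ σ ∈ K \ B, E * ξ ^ μs := by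
          refine Finset.sum_le_sum fun σ hσ => (hN σ).trans ?_
          refine mul_le_mul_of_nonneg_left (pow_le_pow_of_le_one hξ.le hξ1 ?_) hEpos.le
          rw [hμs]
          exact Nat.sInf_le ⟨σ, hσ, rfl⟩
      _ = _ := by
          rw [Finset.sum_const, nsmul_eq_mul, hc]
          ring
  · calc _ ≤ ∑ σ ∈ B, E * ξ ^ μ := by
          refine Finset.sum_le_sum fun σ hσ => (hN σ).trans ?_
          refine mul_le_mul_of_nonneg_left (pow_le_pow_of_le_one hξ.le hξ1 ?_) hEpos.le
          rw [hμ]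
          exact Nat.sInf_le ⟨σ, hB.1 hσ, rfl⟩
      _ = _ := by
          rw [Finset.sum_const, nsmul_eq_mul]
          ring
end

section
/- Let G be a nontrivial subgroup of the symmetric group of a finite set Ω with |Ω| = n, and let μ = min_{g∈G, g≠e} β(g) be the minimal degree of G. For the natural action of G on the m-element subsets of Ω with 0 < m < n, the average stabilizer size ⟨Stab⟩_m satisfies (⟨Stab⟩_m − 1)/|G| < 3·√(m(n−m)/n) · ξ₁^{μ}, where ξ₁ = √(m² + (n−m)²)/n. -/
open Finset

lemma aux_pow (p q r : ℝ) (hp : 0 ≤ p) (hq : 0 ≤ q) (hr : 0 ≤ r) (h : r ^ 2 = p ^ 2 + q ^ 2)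
    (l : ℕ) (hl : 2 ≤ l) : p ^ l + q ^ l ≤ r ^ l := by
  obtain ⟨k, rfl⟩ := Nat.exists_eq_add_of_le hl
  have h1 : p ≤ r := by nlinarith [sq_nonneg q]
  have h2 : q ≤ r := by nlinarith [sq_nonneg p]
  have h3 := pow_le_pow_left₀ hp h1 k
  have h4 := pow_le_pow_left₀ hq h2 k
  rw [pow_add, pow_add, pow_add, h]
  nlinarith [sq_nonneg p, sq_nonneg q, mul_le_mul_of_nonneg_left h3 (sq_nonneg p),
    mul_le_mul_of_nonneg_left h4 (sq_nonneg q)]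

lemma aux_stirling (n m : ℕ) (hm0 : 0 < m) (hmn : m < n) :
    1 ≤ 3 * Real.sqrt ((m : ℝ) * ((n : ℝ) - m) / n) *
      ((n.choose m : ℝ) * (((m : ℝ) / n) ^ m * (((n : ℝ) - m) / n) ^ (n - m))) := by
  obtain ⟨k, rfl⟩ := Nat.exists_eq_add_of_lt hmn
  obtain ⟨j, rfl⟩ : ∃ j, m = j + 1 := ⟨m - 1, by omega⟩
  have up : ∀ a : ℕ, ((a + 1).factorial : ℝ) ≤
      Real.exp 1 * Real.sqrt ((a + 1 : ℕ) : ℝ) * (((a + 1 : ℕ) : ℝ) / Real.exp 1) ^ (a + 1) := by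
    intro a
    have h := Stirling.stirlingSeq'_antitone (Nat.zero_le a)
    simp only [Function.comp, Nat.succ_eq_add_one, zero_add, Stirling.stirlingSeq_one] at h
    rw [Stirling.stirlingSeq, div_le_iff₀ (by positivity)] at h
    refine h.trans (le_of_eq ?_)
    rw [Real.sqrt_mul (by norm_num)]
    have : Real.sqrt 2 ≠ 0 := by positivity
    field_simp
  have low := Stirling.sqrt_pi_le_stirlingSeq (n := j + 1 + k + 1) (by omega)
  rw [Stirling.stirlingSeq, le_div_iff₀ (by positivity)] at low
  have hj := up j
  have hk := up k
  have hc : ((j + 1 + k + 1).choose (j + 1) : ℝ) =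
      ((j + 1 + k + 1).factorial : ℝ) / ((j + 1).factorial * (k + 1).factorial) := by
    rw [Nat.cast_choose ℝ (by omega)]
    congr 4
    omega
  have hnm : j + 1 + k + 1 - (j + 1) = k + 1 := by omega
  have hnm' : ((j + 1 + k + 1 : ℕ) : ℝ) - ((j + 1 : ℕ) : ℝ) = ((k + 1 : ℕ) : ℝ) := by
    push_cast; ring
  have hN : j + 1 + k + 1 = (j + 1) + (k + 1) := by ring
  rw [hnm, hnm', hc]
  have hnpos : (0 : ℝ) < ((j + 1 + k + 1 : ℕ) : ℝ) := by positivity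
  have hmpos : (0 : ℝ) < ((j + 1 : ℕ) : ℝ) := by positivity
  have hkpos : (0 : ℝ) < ((k + 1 : ℕ) : ℝ) := by positivity
  have fj : (0 : ℝ) < ((j + 1).factorial : ℝ) := by positivity
  have fk : (0 : ℝ) < ((k + 1).factorial : ℝ) := by positivity
  generalize ((j + 1).factorial : ℝ) = A at *
  generalize ((k + 1).factorial : ℝ) = B at *
  generalize ((j + 1 + k + 1).factorial : ℝ) = C at *
  generalize ((j + 1 + k + 1 : ℕ) : ℝ) = x at *
  generalize ((j + 1 : ℕ) : ℝ) = y at *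
  generalize ((k + 1 : ℕ) : ℝ) = z at *
  rw [hN] at low
  generalize j + 1 = a at *
  generalize k + 1 = b at *
  have he : Real.exp 1 ^ 2 ≤ 3 * (Real.sqrt Real.pi * Real.sqrt 2) := by
    rw [← Real.sqrt_mul Real.pi_pos.le]
    have h1 := Real.exp_one_lt_d9
    have h2 := Real.pi_gt_d4
    have h3 : (2.47 : ℝ) ≤ Real.sqrt (Real.pi * 2) := by
      apply Real.le_sqrt_of_sq_le; nlinarith
    nlinarith [Real.exp_pos 1]
  have hE := Real.exp_pos 1
  generalize Real.exp 1 = E at *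
  rw [Real.sqrt_mul (by norm_num)] at low
  have hAB := mul_le_mul hj hk fk.le (by positivity)
  rw [show 3 * √(y * z / x) * (C / (A * B) * ((y / x) ^ a * (z / x) ^ b)) =
    (3 * √(y * z / x) * C * ((y / x) ^ a * (z / x) ^ b)) / (A * B) by ring,
    le_div_iff₀ (by positivity), one_mul]
  refine hAB.trans ?_
  have h5 : 3 * √(y * z / x) * (√Real.pi * (√2 * √x * (x / E) ^ (a + b))) * ((y / x) ^ a * (z / x) ^ b) ≤
      3 * √(y * z / x) * C * ((y / x) ^ a * (z / x) ^ b) := by gcongr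
  refine le_trans ?_ h5
  have h6 : √(y * z / x) = √y * √z / √x := by
    rw [Real.sqrt_div (by positivity), Real.sqrt_mul hmpos.le]
  have hx : √x ≠ 0 := by positivity
  have e1 : 3 * √(y * z / x) * (√Real.pi * (√2 * √x * (x / E) ^ (a + b))) * ((y / x) ^ a * (z / x) ^ b)
      = (3 * (√Real.pi * √2)) * (√y * √z * ((y / E) ^ a * (z / E) ^ b)) := by
    rw [h6, pow_add]
    simp only [div_pow]
    field_simp
  have e2 : E * √y * (y / E) ^ a * (E * √z * (z / E) ^ b) =
     E ^ 2 * (√y * √z * ((y / E) ^ a * (z / E) ^ b)) := by ring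
  rw [e1, e2]
  gcongr

lemma aux_fix {Ω : Type*} [Fintype Ω] [DecidableEq Ω] (m : ℕ) (g : Equiv.Perm Ω)
    (p q r : ℝ) (hp : 0 ≤ p) (hq : 0 ≤ q) (hr : 0 ≤ r) (h : r ^ 2 = p ^ 2 + q ^ 2)
    (h1 : p + q = 1) :
    (((powersetCard m (univ : Finset Ω)).filter (fun x => x.image g = x)).card : ℝ) *
      (p ^ m * q ^ (Fintype.card Ω - m)) ≤ r ^ g.support.card := by
  classical
  let S := Equiv.Perm.SameCycle.setoid g
  let Q := Quotient S
  let π : Ω → Q := Quotient.mk S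
  have hπ : Function.Surjective π := Quotient.mk_surjective
  let w : Finset Ω → ℝ := fun x => ∏ i, if i ∈ x then p else q
  let l : Q → ℕ := fun c => (univ.filter (fun i => π i = c)).card
  let P : Finset Q → Finset Ω := fun T => univ.filter (fun i => π i ∈ T)
  have hPinj : Function.Injective P := by
    intro T U hTU
    ext c
    obtain ⟨i, rfl⟩ := hπ c
    have := congrArg (fun s => i ∈ s) hTU
    simpa [P] using this
  have hwnn : ∀ x, 0 ≤ w x := fun x => prod_nonneg (fun i _ => by split_ifs <;> assumption)
  have hwP : ∀ T, w (P T) = ∏ c, if c ∈ T then p ^ l c else q ^ l c := by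
    intro T
    simp only [w]
    rw [← Finset.prod_fiberwise univ π]
    refine prod_congr rfl fun c _ => ?_
    have : ∀ i ∈ univ.filter (fun i => π i = c), (if i ∈ P T then p else q) =
        if c ∈ T then p else q := by
      intro i hi
      have hi' := (mem_filter.1 hi).2
      simp [P, hi']
    rw [prod_congr rfl this, prod_const]
    split_ifs <;> rfl
  have hw : ∀ x ∈ powersetCard m (univ : Finset Ω), w x = p ^ m * q ^ (Fintype.card Ω - m) := by
    intro x hx
    have hc := (mem_powersetCard.1 hx).2
    simp only [w]
    rw [prod_ite, prod_const, prod_const]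
    have a1 : univ.filter (fun i => i ∈ x) = x := by ext; simp
    have a2 : univ.filter (fun i => i ∉ x) = xᶜ := by ext; simp
    rw [a1, a2, card_compl, hc]
  have hsub : (powersetCard m (univ : Finset Ω)).filter (fun x => x.image g = x) ⊆
      univ.image P := by
    intro x hx
    have hgx := (mem_filter.1 hx).2
    have hmap : ∀ i, g i ∈ x ↔ i ∈ x := by
      intro i
      conv_lhs => rw [← hgx]
      simp
    have hz : ∀ (k : ℤ) i, (g ^ k) i ∈ x ↔ i ∈ x := by
      intro k
      induction k using Int.induction_on with
      | zero => simp
      | succ k ih => intro i; rw [zpow_add_one, Equiv.Perm.mul_apply, ih, hmap]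
      | pred k ih =>
        intro i
        rw [zpow_sub_one, Equiv.Perm.mul_apply, ih, ← hmap]; simp
    refine mem_image.2 ⟨x.image π, mem_univ _, ?_⟩
    ext i
    simp only [P, mem_filter, mem_univ, true_and, mem_image]
    constructor
    · rintro ⟨j, hj, hji⟩
      obtain ⟨k, hk⟩ : g.SameCycle j i := Quotient.exact hji
      rw [← hk, hz]; exact hj
    · intro hi; exact ⟨i, hi, rfl⟩
  calc _ = ∑ x ∈ (powersetCard m (univ : Finset Ω)).filter (fun x => x.image g = x), w x := by
        rw [sum_congr rfl fun x hx => hw x (mem_filter.1 hx).1, sum_const, nsmul_eq_mul]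
    _ ≤ ∑ x ∈ univ.image P, w x := sum_le_sum_of_subset_of_nonneg hsub fun x _ _ => hwnn x
    _ = ∑ T, w (P T) := sum_image fun a _ b _ hab => hPinj hab
    _ = ∏ c, (p ^ l c + q ^ l c) := by
        rw [prod_add, powerset_univ]
        refine sum_congr rfl fun T _ => ?_
        rw [hwP, prod_ite]
        congr 2 <;> · ext; simp
    _ ≤ ∏ c, ∏ i ∈ univ.filter (fun i => π i = c), (if i ∈ g.support then r else 1) := by
        refine prod_le_prod (fun c _ => by positivity) fun c _ => ?_
        obtain ⟨i, rfl⟩ := hπ c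
        by_cases hi : g i = i
        · have hf : univ.filter (fun j => π j = π i) = {i} := by
            ext j
            simp only [mem_filter, mem_univ, true_and, mem_singleton]
            constructor
            · intro hj
              have : g.SameCycle j i := Quotient.exact hj
              obtain ⟨k, hk⟩ := this.symm
              rw [← hk]
              exact Equiv.Perm.zpow_apply_eq_self_of_apply_eq_self hi k
            · rintro rfl; rfl
          simp [l, hf, hi, h1]
        · have hall : ∀ j ∈ univ.filter (fun j => π j = π i),
              (if j ∈ g.support then r else 1) = r := by
            intro j hj
            have hj' : g.SameCycle j i := Quotient.exact (mem_filter.1 hj).2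
            rw [if_pos]
            rw [Equiv.Perm.mem_support]
            intro hjj
            exact hi (hj'.apply_eq_self_iff.1 hjj)
          rw [prod_congr rfl hall, prod_const]
          refine aux_pow p q r hp hq hr h _ ?_
          have hs : ({i, g i} : Finset Ω) ⊆ univ.filter (fun j => π j = π i) := by
            intro j hj
            simp only [mem_insert, mem_singleton] at hj
            rw [mem_filter]
            refine ⟨mem_univ _, ?_⟩
            rcases hj with rfl | rfl
            · rfl
            · exact Quotient.sound (show g.SameCycle (g i) i from
                Equiv.Perm.sameCycle_apply_left.2 (Equiv.Perm.SameCycle.refl _ _))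
          calc 2 = ({i, g i} : Finset Ω).card := (card_pair (Ne.symm hi)).symm
            _ ≤ _ := card_le_card hs
    _ = ∏ i, (if i ∈ g.support then r else 1) := Finset.prod_fiberwise univ π _
    _ = r ^ g.support.card := by
        rw [prod_ite_mem]; simp

theorem stmt_9 {Ω : Type*} [Fintype Ω] [DecidableEq Ω] (n m : ℕ)
    (hn : Fintype.card Ω = n) (hm0 : 0 < m) (hmn : m < n)
    (G : Subgroup (Equiv.Perm Ω)) (hG : G ≠ ⊥) (μ : ℕ)
    (hμ : μ = sInf {k : ℕ | ∃ g ∈ G, g ≠ 1 ∧ (Equiv.Perm.support g).card = k}) :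
    ((∑ x ∈ Finset.powersetCard m (univ : Finset Ω),
          ({g : Equiv.Perm Ω | g ∈ G ∧ x.image ⇑g = x}.ncard : ℝ)) /
        ((Finset.powersetCard m (univ : Finset Ω)).card : ℝ) - 1) /
      (Nat.card G : ℝ) <
      3 * Real.sqrt ((m : ℝ) * ((n : ℝ) - m) / n) *
        (Real.sqrt ((m : ℝ) ^ 2 + ((n : ℝ) - m) ^ 2) / n) ^ μ := by
  classical
  have hst := aux_stirling n m hm0 hmn
  have hnpos : (0 : ℝ) < n := by exact_mod_cast hm0.trans hmn
  have hmpos : (0 : ℝ) < m := by exact_mod_cast hm0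
  have hkpos : (0 : ℝ) < (n : ℝ) - m := by
    have : (m : ℝ) < n := by exact_mod_cast hmn
    linarith
  set r := Real.sqrt ((m : ℝ) ^ 2 + ((n : ℝ) - m) ^ 2) / n with hr
  set K := 3 * Real.sqrt ((m : ℝ) * ((n : ℝ) - m) / n) with hK
  have hKpos : 0 < K := by positivity
  have hrpos : 0 < r := by positivity
  have hr2 : r ^ 2 = ((m : ℝ) / n) ^ 2 + (((n : ℝ) - m) / n) ^ 2 := by
    rw [hr, div_pow, Real.sq_sqrt (by positivity)]; ring
  have hpq : (m : ℝ) / n + ((n : ℝ) - m) / n = 1 := by field_simp; ring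
  have hr1 : r ≤ 1 := by
    have : 0 ≤ (m : ℝ) / n * (((n : ℝ) - m) / n) := by positivity
    nlinarith
  have hcard : (powersetCard m (univ : Finset Ω)).card = n.choose m := by
    rw [card_powersetCard, card_univ, hn]
  have hCpos : (0 : ℝ) < n.choose m := by exact_mod_cast Nat.choose_pos hmn.le
  let GF : Finset (Equiv.Perm Ω) := univ.filter (· ∈ G)
  let F : Equiv.Perm Ω → ℝ := fun g =>
    (((powersetCard m (univ : Finset Ω)).filter (fun x => x.image g = x)).card : ℝ)
  have hGF : (Nat.card G : ℝ) = GF.card := by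
    rw [Nat.card_eq_fintype_card, Fintype.card_subtype]
  have h1G : (1 : Equiv.Perm Ω) ∈ GF := by simp [GF, G.one_mem]
  have hsum : (∑ x ∈ Finset.powersetCard m (univ : Finset Ω),
          ({g : Equiv.Perm Ω | g ∈ G ∧ x.image ⇑g = x}.ncard : ℝ)) = ∑ g ∈ GF, F g := by
    have e1 : ∀ x : Finset Ω, ({g : Equiv.Perm Ω | g ∈ G ∧ x.image ⇑g = x}.ncard : ℝ) =
        ∑ g ∈ GF, if x.image ⇑g = x then (1 : ℝ) else 0 := by
      intro x
      rw [← sum_filter, sum_const, nsmul_eq_mul, mul_one, ← Set.ncard_coe_finset]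
      congr 2
      ext g
      simp [GF]
    simp only [e1]
    rw [sum_comm]
    refine sum_congr rfl fun g _ => ?_
    rw [← sum_filter, sum_const, nsmul_eq_mul, mul_one]
  have hF1 : F 1 = n.choose m := by
    simp only [F]
    rw [filter_true_of_mem, hcard]
    intro x _
    simp
  have hFg : ∀ g ∈ GF.erase 1, F g ≤ n.choose m * (K * r ^ μ) := by
    intro g hg
    have hg1 := (mem_erase.1 hg).1
    have hgG : g ∈ G := by simpa [GF] using (mem_erase.1 hg).2
    have hle : μ ≤ g.support.card := by
      rw [hμ]; exact Nat.sInf_le ⟨g, hgG, hg1, rfl⟩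
    have h := aux_fix m g (m / n) ((n - m) / n) r (by positivity) (by positivity) hrpos.le hr2 hpq
    rw [hn] at h
    have h' := h.trans (pow_le_pow_of_le_one hrpos.le hr1 hle)
    have hF0 : 0 ≤ F g := Nat.cast_nonneg _
    calc F g = F g * 1 := (mul_one _).symm
      _ ≤ F g * (K * ((n.choose m : ℝ) * (((m : ℝ) / n) ^ m * (((n : ℝ) - m) / n) ^ (n - m)))) := by
        gcongr
      _ = n.choose m * (K * (F g * (((m : ℝ) / n) ^ m * (((n : ℝ) - m) / n) ^ (n - m)))) := by ring
      _ ≤ _ := by gcongr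
  have hGpos : (0 : ℝ) < GF.card := by exact_mod_cast card_pos.2 ⟨1, h1G⟩
  rw [hsum, hcard, hGF, div_lt_iff₀ hGpos, ← add_sum_erase _ _ h1G, hF1, add_div,
    div_self hCpos.ne', add_sub_cancel_left, div_lt_iff₀ hCpos]
  have hle := sum_le_sum hFg
  rw [sum_const, nsmul_eq_mul, cast_card_erase_of_mem h1G] at hle
  have : 0 < n.choose m * (K * r ^ μ) := by positivity
  nlinarith
end

section
/- Let G be a nontrivial subgroup of the symmetric group of a finite set Ω with |Ω| = n ≥ 1, with minimal degree μ = min_{g∈G, g≠e} β(g). Let B be a subset of G containing the identity with B ≠ G, and let μ* = min_{g∈G∖B} β(g). Then for the natural action of G on multisets of size m > 0 on Ω, the average stabilizer size satisfies ⟨Stab⟩_{(m)} − 1 < 3·√(m(n+m)/n) · (|G|·ξ₂^{μ*} + |B|·ξ₂^{μ}), where ξ₂ = √(n/(n+2m)). -/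
open Finset

lemma aux_pow_s14 {x z : ℝ} (hx0 : 0 < x) (hx1 : x < 1) (hz : 0 < z) (hzx : z ^ 2 = 1 - x ^ 2)
    {c : ℕ} (hc : 2 ≤ c) : (1 - x ^ c)⁻¹ ≤ (z⁻¹) ^ c := by
  have hz1 : z ≤ 1 := by nlinarith
  have h1 : x ^ c ≤ x ^ 2 := pow_le_pow_of_le_one hx0.le hx1.le hc
  have h2 : z ^ c ≤ z ^ 2 := pow_le_pow_of_le_one hz.le hz1 hc
  rw [inv_pow]
  apply inv_anti₀ (by positivity)
  linarith

lemma geo_le {r : ℝ} (h0 : 0 ≤ r) (h1 : r < 1) (k : ℕ) :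
    ∑ j ∈ range k, r ^ j ≤ (1 - r)⁻¹ := by
  rw [← tsum_geometric_of_lt_one h0 h1]
  exact (summable_geometric_of_lt_one h0 h1).sum_le_tsum _ (fun i _ => by positivity)

lemma fix_bound {Ω : Type*} [Fintype Ω] [DecidableEq Ω] (m : ℕ) (g : Equiv.Perm Ω)
    {x ξ : ℝ} (hx0 : 0 < x) (hx1 : x < 1) (hξ : 0 < ξ) (hξx : ξ ^ 2 * (1 + x) = 1 - x) :
    (((piAntidiag (univ : Finset Ω) m).filter (fun κ => κ ∘ ⇑g = κ)).card : ℝ) * x ^ m ≤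
      ((1 - x)⁻¹) ^ Fintype.card Ω * ξ ^ (g.support.card) := by
  classical
  let S := Equiv.Perm.SameCycle.setoid g
  let c : Quotient S → ℕ := fun q => (univ.filter (fun ω : Ω => (Quotient.mk S ω) = q)).card
  let T := (Fintype.piFinset (fun _ : Quotient S => range (m + 1))).filter
    (fun f => ∑ q, c q * f q = m)
  have hsum : ∀ f : Quotient S → ℕ, ∑ ω, f (Quotient.mk S ω) = ∑ q, c q * f q := by
    intro f
    rw [← Finset.sum_fiberwise' univ (fun ω : Ω => Quotient.mk S ω) f]
    simp [c]
  have hcpos : ∀ q, 1 ≤ c q := by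
    intro q
    obtain ⟨ω, rfl⟩ := Quotient.exists_rep q
    exact Finset.card_pos.2 ⟨ω, by simp⟩
  have hcard : ((piAntidiag (univ : Finset Ω) m).filter (fun κ => κ ∘ ⇑g = κ)).card ≤ T.card := by
    have : (piAntidiag (univ : Finset Ω) m).filter (fun κ => κ ∘ ⇑g = κ) ⊆
        T.image (fun f ω => f (Quotient.mk S ω)) := by
      intro κ hκ
      simp only [mem_filter, mem_piAntidiag] at hκ
      obtain ⟨⟨hs, -⟩, hg⟩ := hκ
      have hinv : ∀ a b : Ω, S a b → κ a = κ b := by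
        rintro a b ⟨i, rfl⟩
        have hN : ∀ (k : ℕ) (a : Ω), κ ((g ^ k) a) = κ a := by
          intro k
          induction k with
          | zero => intro a; simp
          | succ k ih => intro a; rw [pow_succ, Equiv.Perm.mul_apply, ih]; exact congrFun hg a
        obtain ⟨k, rfl | rfl⟩ := i.eq_nat_or_neg
        · rw [zpow_natCast, hN]
        · have := hN k ((g ^ (-(k : ℤ))) a)
          rw [← this, ← Equiv.Perm.mul_apply, ← zpow_natCast, ← zpow_add]
          simp
      let f : Quotient S → ℕ := Quotient.lift κ hinv
      have hf : ∑ q, c q * f q = m := by rw [← hsum, ← hs]; rfl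
      refine mem_image.2 ⟨f, ?_, rfl⟩
      simp only [T, mem_filter, Fintype.mem_piFinset, mem_range]
      refine ⟨fun q => ?_, hf⟩
      have h1 : c q * f q ≤ ∑ q, c q * f q :=
        Finset.single_le_sum (f := fun q => c q * f q) (fun _ _ => Nat.zero_le _) (mem_univ q)
      have := hcpos q
      nlinarith
    exact (card_le_card this).trans card_image_le
  have h1 : (T.card : ℝ) * x ^ m ≤ ∏ q, ∑ j ∈ range (m + 1), (x ^ c q) ^ j := by
    rw [Finset.prod_univ_sum]
    calc (T.card : ℝ) * x ^ m = ∑ f ∈ T, x ^ m := by simp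
      _ = ∑ f ∈ T, ∏ q, (x ^ c q) ^ (f q) := by
        apply sum_congr rfl
        intro f hf
        simp only [T, mem_filter] at hf
        rw [← hf.2, ← prod_pow_eq_pow_sum]
        simp [pow_mul]
      _ ≤ _ := by
        apply sum_le_sum_of_subset_of_nonneg (filter_subset _ _)
        intros; positivity
  have h2 : ∏ q, ∑ j ∈ range (m + 1), (x ^ c q) ^ j ≤
      ∏ q, ∏ ω ∈ univ.filter (fun ω : Ω => (Quotient.mk S ω) = q),
        ((1 - x)⁻¹ * (if g ω = ω then 1 else ξ)) := by
    apply prod_le_prod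
    · intros; positivity
    intro q _
    refine (geo_le (by positivity) (pow_lt_one₀ hx0.le hx1 (by have := hcpos q; omega)) _).trans ?_
    obtain ⟨ω, rfl⟩ := Quotient.exists_rep q
    by_cases hω : g ω = ω
    · have : univ.filter (fun ω' : Ω => (Quotient.mk S ω') = Quotient.mk S ω) = {ω} := by
        ext ω'
        simp only [mem_filter, mem_univ, true_and, mem_singleton, Quotient.eq]
        constructor
        · intro h
          have h' : g.SameCycle ω ω' := Equiv.Perm.SameCycle.symm h
          exact (h'.eq_of_left hω).symm
        · rintro rfl; exact Equiv.Perm.SameCycle.refl _ _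
      have hc : c (Quotient.mk S ω) = 1 := by simp only [c, this, card_singleton]
      rw [hc]
      simp only [this, prod_singleton, hω]
      simp
    · have hall : ∀ ω' ∈ univ.filter (fun ω' : Ω => (Quotient.mk S ω') = Quotient.mk S ω),
          ((1 - x)⁻¹ * (if g ω' = ω' then 1 else ξ)) = ((1 - x) / ξ)⁻¹ := by
        intro ω' h
        simp only [mem_filter, mem_univ, true_and, Quotient.eq] at h
        have h' : g.SameCycle ω' ω := h
        have : g ω' ≠ ω' := by
          intro h3
          have := h'.eq_of_left h3
          subst this; exact hω h3
        rw [if_neg this, inv_div, div_eq_inv_mul]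
      rw [prod_congr rfl hall, prod_const]
      have hc : 2 ≤ c (Quotient.mk S ω) := by
        refine Finset.one_lt_card.2 ⟨ω, by simp, g ω, ?_, fun h => hω h.symm⟩
        simp only [mem_filter, mem_univ, true_and, Quotient.eq]
        exact Equiv.Perm.sameCycle_apply_left.2 (Equiv.Perm.SameCycle.refl _ _)
      refine aux_pow_s14 hx0 hx1 (div_pos (by linarith) hξ) ?_ hc
      rw [div_pow, div_eq_iff (by positivity)]
      nlinarith
  rw [Finset.prod_fiberwise] at h2
  have h3 : ∏ ω : Ω, ((1 - x)⁻¹ * (if g ω = ω then 1 else ξ)) =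
      ((1 - x)⁻¹) ^ Fintype.card Ω * ξ ^ (g.support.card) := by
    rw [prod_mul_distrib, prod_const, prod_ite, prod_const, prod_const]
    simp [Equiv.Perm.support, Finset.card_univ]
  rw [← h3]
  refine le_trans ?_ (h1.trans h2)
  gcongr

open Stirling in
lemma stirling_bound {n m : ℕ} (hn : 1 ≤ n) (hm : 1 ≤ m) :
    √2 * (stirlingSeq n * stirlingSeq m) ≤ 3 * stirlingSeq (n + m) := by
  have anti : ∀ a b : ℕ, 1 ≤ a → a ≤ b → stirlingSeq b ≤ stirlingSeq a := by
    intro a b ha hab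
    have := stirlingSeq'_antitone (show a - 1 ≤ b - 1 by omega)
    simp only [Function.comp, Nat.succ_eq_add_one] at this
    rwa [Nat.sub_add_cancel ha, Nat.sub_add_cancel (by omega)] at this
  have pos : ∀ a : ℕ, 1 ≤ a → 0 < stirlingSeq a := by
    intro a ha
    have := stirlingSeq'_pos (a - 1)
    rwa [Nat.sub_add_cancel ha] at this
  have he := Real.exp_one_lt_d9
  have he0 := Real.exp_one_gt_d9
  have hpi := Real.pi_gt_d4
  have s2 : (√2) ^ 2 = 2 := Real.sq_sqrt (by norm_num)
  have s2p : 0 < √2 := by positivity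
  have s2u : √2 < 1.4143 := by rw [Real.sqrt_lt' (by norm_num)]; norm_num
  have s2l : 1.4142 < √2 := by rw [Real.lt_sqrt (by norm_num)]; norm_num
  have spi : 1.77 ≤ √Real.pi := by
    apply Real.le_sqrt_of_sq_le; linarith
  have S1 : √2 * stirlingSeq 1 = Real.exp 1 := by rw [stirlingSeq_one]; field_simp
  have S2 : stirlingSeq 2 = Real.exp 1 ^ 2 / 4 := by
    unfold stirlingSeq
    have : √(2 * ((2 : ℕ) : ℝ)) = 2 := by
      rw [show (2 * ((2 : ℕ) : ℝ)) = 2 ^ 2 by norm_num]; exact Real.sqrt_sq (by norm_num)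
    rw [this]
    simp [Nat.factorial]
    have h2 : Real.exp 2 = Real.exp 1 ^ 2 := by rw [← Real.exp_nat_mul]; norm_num
    field_simp
    rw [h2]
    ring
  have S2u : stirlingSeq 2 ≤ 1.848 := by rw [S2]; nlinarith
  have key1 : ∀ k, 1 ≤ k → Real.exp 1 * stirlingSeq k ≤ 3 * stirlingSeq (k + 1) := by
    intro k hk
    rcases hk.eq_or_lt with rfl | hk
    · have : stirlingSeq 1 = Real.exp 1 / √2 := stirlingSeq_one
      rw [this, S2]
      have : 1 / √2 ≤ 3 / 4 := by rw [div_le_iff₀ s2p]; linarith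
      have h := mul_le_mul_of_nonneg_left this (sq_nonneg (Real.exp 1))
      calc _ = Real.exp 1 ^ 2 * (1 / √2) := by ring
        _ ≤ _ := h
        _ = _ := by ring
    · have h1 := anti 2 k (by norm_num) hk
      have h2 : √Real.pi ≤ stirlingSeq (k + 1) := sqrt_pi_le_stirlingSeq (by omega)
      have := pos k (by omega)
      calc Real.exp 1 * stirlingSeq k ≤ 2.7182818286 * 1.848 := by
            gcongr; linarith
        _ ≤ 3 * 1.77 := by norm_num
        _ ≤ _ := by linarith
  rcases hm.eq_or_lt with rfl | hm2
  · calc _ = (√2 * stirlingSeq 1) * stirlingSeq n := by ring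
      _ ≤ _ := by rw [S1]; exact key1 n hn
  rcases hn.eq_or_lt with rfl | hn2
  · calc _ = (√2 * stirlingSeq 1) * stirlingSeq m := by ring
      _ ≤ _ := by rw [S1, add_comm 1 m]; exact key1 m hm
  have h1 := (anti 2 n (by norm_num) hn2).trans S2u
  have h3 := (anti 2 m (by norm_num) hm2).trans S2u
  have h2 : √Real.pi ≤ stirlingSeq (n + m) := sqrt_pi_le_stirlingSeq (by omega)
  have := pos n hn
  have := pos m hm
  calc √2 * (stirlingSeq n * stirlingSeq m) ≤ 1.4143 * (1.848 * 1.848) := by gcongr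
    _ ≤ 3 * 1.77 := by norm_num
    _ ≤ _ := by linarith

lemma fact_eq {k : ℕ} (hk : 1 ≤ k) :
    (k.factorial : ℝ) = Stirling.stirlingSeq k * (√2 * √(k : ℝ)) * ((k : ℝ) ^ k / Real.exp 1 ^ k) := by
  have : (0 : ℝ) < k := by exact_mod_cast hk
  unfold Stirling.stirlingSeq
  rw [Real.sqrt_mul (by norm_num), div_pow]
  field_simp

lemma total_bound {n m : ℕ} (hn : 1 ≤ n) (hm : 1 ≤ m) :
    ((n : ℝ) + m) ^ (n + m) ≤ 3 * √((m : ℝ) * ((n : ℝ) + m) / n) *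
      (n.multichoose m : ℝ) * ((m : ℝ) ^ m * (n : ℝ) ^ n) := by
  have hn' : (0 : ℝ) < n := by exact_mod_cast hn
  have hm' : (0 : ℝ) < m := by exact_mod_cast hm
  have hmc : (n.multichoose m : ℝ) * (m.factorial * n.factorial) * ((n : ℝ) + m) =
      n * (n + m).factorial := by
    rw [Nat.multichoose_eq]
    obtain ⟨k, rfl⟩ := Nat.exists_eq_add_of_le' hn
    have h := Nat.add_choose_mul_factorial_mul_factorial k m
    have e : k + 1 + m - 1 = k + m := by omega
    have e2 : k + 1 + m = (k + m) + 1 := by omega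
    rw [e, e2, Nat.factorial_succ, Nat.factorial_succ, ← h]
    push_cast
    ring
  have hb := stirling_bound hn hm
  rw [fact_eq hn, fact_eq hm, fact_eq (show 1 ≤ n + m by omega)] at hmc
  push_cast at hmc
  have hS : 0 < Stirling.stirlingSeq (n + m) := by
    have := Stirling.stirlingSeq'_pos (n + m - 1)
    rwa [Nat.sub_add_cancel (by omega)] at this
  have e1 : √((m : ℝ) * ((n : ℝ) + m) / n) = √(m : ℝ) * √((n : ℝ) + m) / √(n : ℝ) := by
    rw [Real.sqrt_div (by positivity), Real.sqrt_mul (by positivity)]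
  rw [e1]
  set A := Stirling.stirlingSeq n
  set B := Stirling.stirlingSeq m
  set C := Stirling.stirlingSeq (n + m)
  have hsn : (√(n : ℝ)) ^ 2 = n := Real.sq_sqrt hn'.le
  have hsnm : (√((n : ℝ) + m)) ^ 2 = (n : ℝ) + m := Real.sq_sqrt (by positivity)
  have hsn0 : 0 < √(n : ℝ) := by positivity
  have hsm0 : 0 < √(m : ℝ) := by positivity
  have hsnm0 : 0 < √((n : ℝ) + m) := by positivity
  have hs2 : 0 < √(2 : ℝ) := by positivity
  rw [pow_add (Real.exp 1)] at hmc
  have hE1 : 0 < Real.exp 1 ^ n := by positivity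
  have hE2 : 0 < Real.exp 1 ^ m := by positivity
  set X := ((n : ℝ) + m) ^ (n + m)
  set M := (n.multichoose m : ℝ)
  set P := (m : ℝ) ^ m
  set Q := (n : ℝ) ^ n
  set a := √(n : ℝ)
  set b := √(m : ℝ)
  set d := √((n : ℝ) + m)
  have h4 : M * P * Q * √2 * (A * B) * b * d = a * C * X := by
    rw [← hsnm, ← hsn] at hmc
    field_simp at hmc
    linear_combination hmc
  have hle : a * C * X ≤ (3 * C) * (M * P * Q * b * d) := by
    rw [← h4]
    calc _ = (√2 * (A * B)) * (M * P * Q * b * d) := by ring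
      _ ≤ _ := by gcongr
  have : a * C * X ≤ a * C * (3 * (b * d / a) * M * (P * Q)) := by
    calc _ ≤ _ := hle
      _ = _ := by field_simp
  exact le_of_mul_le_mul_left this (by positivity)



/-- Theorem 4.3, inequality (30): for a nontrivial permutation group `G` of minimal
degree `μ`, a subset `B` of `G` containing the identity with `B ≠ G`, and
`μ* = min_{g ∈ G∖B} β(g)`, the average stabilizer size of the action of `G` on multisets
of size `m > 0` (multiplicity functions `κ : Ω → ℕ` with sum `m`) satisfies
`⟨Stab⟩_{(m)} - 1 < 3 √(m(n+m)/n) (|G| ξ₂^{μ*} + |B| ξ₂^{μ})`. The average stabilizer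
size is expressed via the count of passive pairs divided by the number of multisets. -/
theorem stmt_14 {Ω : Type*} [Fintype Ω] [DecidableEq Ω] (n m : ℕ)
    (hn : Fintype.card Ω = n) (hn1 : 1 ≤ n) (hm : 0 < m)
    (G : Subgroup (Equiv.Perm Ω)) (hG : G ≠ ⊥) (μ : ℕ)
    (hμ : μ = sInf {k : ℕ | ∃ g ∈ G, g ≠ 1 ∧ (Equiv.Perm.support g).card = k})
    (B : Set (Equiv.Perm Ω)) (hBG : B ⊆ (G : Set (Equiv.Perm Ω)))
    (hB1 : (1 : Equiv.Perm Ω) ∈ B) (hBne : B ≠ (G : Set (Equiv.Perm Ω))) (μs : ℕ)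
    (hμs : μs = sInf {k : ℕ |
        ∃ g ∈ (G : Set (Equiv.Perm Ω)) \ B, (Equiv.Perm.support g).card = k}) :
    ({p : Equiv.Perm Ω × (Ω → ℕ) |
          p.1 ∈ G ∧ (∑ ω, p.2 ω) = m ∧ p.2 ∘ ⇑p.1 = p.2}.ncard : ℝ) /
        ({κ : Ω → ℕ | (∑ ω, κ ω) = m}.ncard : ℝ) - 1 <
      3 * Real.sqrt ((m : ℝ) * ((n : ℝ) + m) / n) *
        ((Nat.card G : ℝ) * Real.sqrt ((n : ℝ) / ((n : ℝ) + 2 * m)) ^ μs +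
          (B.ncard : ℝ) * Real.sqrt ((n : ℝ) / ((n : ℝ) + 2 * m)) ^ μ) := by
  classical
  have hn' : (0 : ℝ) < n := by exact_mod_cast hn1
  have hm' : (0 : ℝ) < m := by exact_mod_cast hm
  set ξ := Real.sqrt ((n : ℝ) / ((n : ℝ) + 2 * m)) with hξ
  have hξ0 : 0 < ξ := by positivity
  have hξ2 : ξ ^ 2 = (n : ℝ) / ((n : ℝ) + 2 * m) := Real.sq_sqrt (by positivity)
  have hξ1 : ξ ≤ 1 := by
    rw [hξ, Real.sqrt_le_iff]; refine ⟨zero_le_one, ?_⟩; rw [one_pow, div_le_one (by positivity)]; linarith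
  set K := 3 * Real.sqrt ((m : ℝ) * ((n : ℝ) + m) / n) with hK
  have hK0 : 0 < K := by positivity
  set F := piAntidiag (univ : Finset Ω) m with hF
  have hFset : {κ : Ω → ℕ | (∑ ω, κ ω) = m} = (F : Set (Ω → ℕ)) := by
    ext κ; simp [hF]
  have hFcard : F.card = n.multichoose m := by
    rw [← hn, ← Sym.card_sym_eq_multichoose Ω m,
      ← Nat.card_eq_fintype_card, Nat.card_congr (Sym.equivNatSumOfFintype Ω m),
      ← Set.ncard_coe_finset, ← hFset]
    rfl
  have hFpos : (0 : ℝ) < F.card := by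
    rw [hFcard]
    have : 0 < n.multichoose m := by
      rw [Nat.multichoose_eq]; exact Nat.choose_pos (by omega)
    exact_mod_cast this
  let fx : Equiv.Perm Ω → ℕ := fun g => (F.filter (fun κ => κ ∘ ⇑g = κ)).card
  let Gf : Finset (Equiv.Perm Ω) := univ.filter (fun g => g ∈ G)
  have hpairs : {p : Equiv.Perm Ω × (Ω → ℕ) |
          p.1 ∈ G ∧ (∑ ω, p.2 ω) = m ∧ p.2 ∘ ⇑p.1 = p.2}.ncard = ∑ g ∈ Gf, fx g := by
    have : {p : Equiv.Perm Ω × (Ω → ℕ) |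
          p.1 ∈ G ∧ (∑ ω, p.2 ω) = m ∧ p.2 ∘ ⇑p.1 = p.2} =
        (((Gf ×ˢ F).filter (fun p : Equiv.Perm Ω × (Ω → ℕ) => p.2 ∘ ⇑p.1 = p.2) : Finset _) :
          Set (Equiv.Perm Ω × (Ω → ℕ))) := by
      ext p; simp [hF, Gf, and_assoc]
    rw [this, Set.ncard_coe_finset, card_filter, sum_product]
    simp only [fx, card_filter]
  have hfx : ∀ g, (fx g : ℝ) ≤ K * F.card * ξ ^ g.support.card := by
    intro g
    set x : ℝ := m / (n + m) with hx
    have hx0 : 0 < x := by positivity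
    have hx1 : x < 1 := by rw [hx, div_lt_one (by positivity)]; linarith
    have h1x : 1 - x = n / (n + m) := by rw [hx]; field_simp; ring
    have hb := fix_bound m g hx0 hx1 hξ0 (by rw [hξ2, h1x, hx]; field_simp; ring)
    rw [h1x, hn, inv_div, hx, div_pow, div_pow] at hb
    have ht := total_bound hn1 hm
    rw [← hK, ← hFcard] at ht
    have hnm : (0 : ℝ) < (n : ℝ) + m := by positivity
    have h5 : (fx g : ℝ) * ((m : ℝ) ^ m * (n : ℝ) ^ n) ≤
        ((n : ℝ) + m) ^ (n + m) * ξ ^ g.support.card := by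
      have := mul_le_mul_of_nonneg_right hb
        (show (0 : ℝ) ≤ ((n : ℝ) + m) ^ m * (n : ℝ) ^ n by positivity)
      rw [pow_add]
      refine le_trans (le_of_eq ?_) (this.trans (le_of_eq ?_))
      · field_simp
        rfl
      · field_simp
    have h6 : (fx g : ℝ) * ((m : ℝ) ^ m * (n : ℝ) ^ n) ≤
        (K * F.card * ξ ^ g.support.card) * ((m : ℝ) ^ m * (n : ℝ) ^ n) := by
      refine h5.trans ?_
      calc _ ≤ (K * F.card * ((m : ℝ) ^ m * (n : ℝ) ^ n)) * ξ ^ g.support.card := by gcongr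
        _ = _ := by ring
    exact le_of_mul_le_mul_right h6 (by positivity)
  have h1G : (1 : Equiv.Perm Ω) ∈ Gf := by simp [Gf, G.one_mem]
  have hfx1 : fx 1 = F.card := by simp [fx]
  let Bf : Finset (Equiv.Perm Ω) := univ.filter (fun g => g ∈ B)
  have hBc : B.ncard = Bf.card := by
    rw [← Set.ncard_coe_finset]; simp [Bf]
  have hGc : Nat.card G = Gf.card := by
    rw [← Set.ncard_coe_finset, ← Nat.card_coe_set_eq]; simp [Gf]
  have h1B : (1 : Equiv.Perm Ω) ∈ Bf := by simp [Bf, hB1]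
  have hBGf : Bf ⊆ Gf := by
    intro g hg
    simp only [Bf, Gf, mem_filter, mem_univ, true_and] at hg ⊢
    exact hBG hg
  have hsum : ∑ g ∈ Gf, (fx g : ℝ) ≤ F.card + (K * F.card) *
      (Gf.card * ξ ^ μs + ((Bf.card : ℝ) - 1) * ξ ^ μ) := by
    rw [← sum_sdiff hBGf, ← add_sum_erase Bf _ h1B, hfx1]
    have e1 : ∑ g ∈ Gf \ Bf, (fx g : ℝ) ≤ Gf.card * (K * F.card * ξ ^ μs) := by
      calc _ ≤ ∑ g ∈ Gf \ Bf, (K * F.card * ξ ^ μs) := by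
            apply sum_le_sum
            intro g hg
            refine (hfx g).trans ?_
            apply mul_le_mul_of_nonneg_left _ (by positivity)
            apply pow_le_pow_of_le_one hξ0.le hξ1
            rw [hμs]
            apply Nat.sInf_le
            simp only [Gf, Bf, mem_sdiff, mem_filter, mem_univ, true_and] at hg
            exact ⟨g, hg, rfl⟩
        _ = (Gf \ Bf).card * (K * F.card * ξ ^ μs) := by simp
        _ ≤ _ := by
            gcongr
            exact sdiff_subset
    have e2 : ∑ g ∈ Bf.erase 1, (fx g : ℝ) ≤ ((Bf.card : ℝ) - 1) * (K * F.card * ξ ^ μ) := by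
      calc _ ≤ ∑ g ∈ Bf.erase 1, (K * F.card * ξ ^ μ) := by
            apply sum_le_sum
            intro g hg
            refine (hfx g).trans ?_
            apply mul_le_mul_of_nonneg_left _ (by positivity)
            apply pow_le_pow_of_le_one hξ0.le hξ1
            rw [hμ]
            apply Nat.sInf_le
            simp only [Bf, mem_erase, mem_filter, mem_univ, true_and] at hg
            exact ⟨g, hBG hg.2, hg.1, rfl⟩
        _ = (Bf.erase 1).card * (K * F.card * ξ ^ μ) := by simp
        _ = _ := by
            rw [card_erase_of_mem h1B, Nat.cast_sub (card_pos.2 ⟨1, h1B⟩)]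
            simp
    linarith
  rw [hpairs, hFset, Set.ncard_coe_finset, hBc, hGc, sub_lt_iff_lt_add, div_lt_iff₀ hFpos]
  push_cast
  refine hsum.trans_lt ?_
  have : 0 < K * F.card * ξ ^ μ := by positivity
  linarith
end
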